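/- Let N ≥ 2 and let L be a positive definite Jacobi index of rank N. There exists a finite set S of nonzero vectors in ℤ^N, depending only on L, with the following property. Let k ∈ ℤ and let φ : ℍ × ℂ^N → ℂ be a function such that for every τ ∈ ℍ the map z ↦ φ(τ, z) is holomorphic, φ(τ + 1, z) = φ(τ, z) for all (τ, z), and for every τ ∈ ℍ the function z ↦ φ(τ, z) is elliptic with respect to L and τ. If for every s ∈ S the function φ_s : ℍ × ℂ → ℂ, φ_s(τ, w) = φ(τ, w·s), satisfies the weight-k index-(sᵀLs) Jacobi transformation laws, then φ satisfies the weight-k index-L Jacobi transformation laws. -/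

import Mathlib

open Matrix Complex UpperHalfPlane
open scoped MatrixGroups

noncomputable section

/-- `e(x) = exp(2πi·x)`. -/
def eC (x : ℂ) : ℂ := Complex.exp (2 * Real.pi * Complex.I * x)

/-- The casting `ℤ^N → ℂ^N`. -/
def zc {N : ℕ} (lam : Fin N → ℤ) : Fin N → ℂ := fun i => (lam i : ℂ)

/-- A function `f : ℂ^N → ℂ` is elliptic with respect to a Jacobi index `L` and `τ` if
`f(z + λτ + μ) = e(−τ·λᵀLλ/2 − λᵀLz)·f(z)` for all `λ, μ ∈ ℤ^N`. -/
def IsElliptic {N : ℕ} (L : Matrix (Fin N) (Fin N) ℤ) (τ : ℂ) (f : (Fin N → ℂ) → ℂ) : Prop :=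
  ∀ lam mu : Fin N → ℤ, ∀ z : Fin N → ℂ,
    f (fun i => z i + (lam i : ℂ) * τ + (mu i : ℂ)) =
      eC (-(τ * (zc lam ⬝ᵥ (L.map (Int.cast : ℤ → ℂ)).mulVec (zc lam)) / 2)
          - zc lam ⬝ᵥ (L.map (Int.cast : ℤ → ℂ)).mulVec z) * f z

/-- `φ : ℍ × ℂ^N → ℂ` satisfies the weight-`k` index-`L` Jacobi transformation laws. -/
def SatisfiesJacobiLaws (k : ℤ) {N : ℕ} (L : Matrix (Fin N) (Fin N) ℤ)
    (φ : UpperHalfPlane → (Fin N → ℂ) → ℂ) : Prop :=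
  (∀ γ : Matrix.SpecialLinearGroup (Fin 2) ℤ, ∀ τ : UpperHalfPlane, ∀ z : Fin N → ℂ,
    φ (γ • τ) (fun i => z i / ((γ 1 0 : ℂ) * (τ : ℂ) + (γ 1 1 : ℂ))) =
      ((γ 1 0 : ℂ) * (τ : ℂ) + (γ 1 1 : ℂ)) ^ k *
        eC ((γ 1 0 : ℂ) * (z ⬝ᵥ (L.map (Int.cast : ℤ → ℂ)).mulVec z) /
          (2 * ((γ 1 0 : ℂ) * (τ : ℂ) + (γ 1 1 : ℂ)))) * φ τ z) ∧
  ∀ τ : UpperHalfPlane, IsElliptic L (τ : ℂ) (φ τ)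

theorem norm_le_of_zeros (T : Finset ℂ) (c : ℂ) {r : ℝ} (hr : 0 < r) (hTr : ∀ z ∈ T, ‖z - c‖ ≤ r) :
    ∀ (f : ℂ → ℂ) (B : ℝ), Differentiable ℂ f → (∀ z ∈ T, f z = 0) →
      (∀ x, ‖x - c‖ = 4 * r → ‖f x‖ ≤ B) → ‖f c‖ ≤ B * (1 / 3) ^ T.card := by
  classical
  induction T using Finset.induction_on with
  | empty =>
    intro f B hf _ hB
    simp only [Finset.card_empty, pow_zero, mul_one]
    refine Complex.norm_le_of_forall_mem_frontier_norm_le (U := Metric.ball c (4 * r))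
      Metric.isBounded_ball hf.diffContOnCl (fun x hx => hB x ?_)
      (subset_closure (Metric.mem_ball_self (by positivity)))
    rw [frontier_ball c (by positivity), mem_sphere_iff_norm] at hx
    exact hx
  | insert z T hz ih =>
    intro f B hf hT hB
    have hfz : f z = 0 := hT z (Finset.mem_insert_self _ _)
    have hzr : ‖z - c‖ ≤ r := hTr z (Finset.mem_insert_self _ _)
    have hmul : ∀ x, f x = (x - z) * dslope f z x := by
      intro x
      have := sub_smul_dslope f z x
      rw [smul_eq_mul, hfz, sub_zero] at this
      exact this.symm
    have hd : Differentiable ℂ (dslope f z) := by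
      rw [← differentiableOn_univ] at hf ⊢
      exact (Complex.differentiableOn_dslope Filter.univ_mem).2 hf
    have hdT : ∀ x ∈ T, dslope f z x = 0 := by
      intro x hx
      have h0 := hT x (Finset.mem_insert_of_mem hx)
      rw [hmul x] at h0
      refine (mul_eq_zero.1 h0).resolve_left (sub_ne_zero.2 ?_)
      rintro rfl
      exact hz hx
    have hdB : ∀ x, ‖x - c‖ = 4 * r → ‖dslope f z x‖ ≤ B / (3 * r) := by
      intro x hx
      have h1 : 3 * r ≤ ‖x - z‖ := by
        have := norm_sub_norm_le (x - c) (z - c)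
        rw [sub_sub_sub_cancel_right] at this
        linarith
      have h2 := hB x hx
      rw [hmul x, norm_mul] at h2
      rw [le_div_iff₀ (by positivity), mul_comm]
      exact (mul_le_mul_of_nonneg_right h1 (norm_nonneg _)).trans h2
    have h := ih (fun x hx => hTr x (Finset.mem_insert_of_mem hx)) _ _ hd hdT hdB
    rw [hmul c, norm_mul, norm_sub_rev, Finset.card_insert_of_notMem hz, pow_succ]
    calc ‖z - c‖ * ‖dslope f z c‖ ≤ r * (B / (3 * r) * (1 / 3) ^ T.card) :=
          mul_le_mul hzr h (norm_nonneg _) hr.le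
      _ = B * ((1 / 3) ^ T.card * (1 / 3)) := by field_simp

theorem even_dotProduct_mulVec_self {N : ℕ} {L : Matrix (Fin N) (Fin N) ℤ} (hSym : L.IsSymm)
    (hEven : ∀ i, Even (L i i)) (x : Fin N → ℤ) : Even (x ⬝ᵥ L.mulVec x) := by
  rw [← ZMod.intCast_eq_zero_iff_even]
  simp only [dotProduct, Matrix.mulVec, Finset.mul_sum]
  rw [← Finset.sum_product', Int.cast_sum]
  refine Finset.sum_involution (fun p _ => (p.2, p.1)) ?_ ?_ (by simp) (by simp)
  · rintro ⟨i, j⟩ -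
    rw [← Int.cast_add, ZMod.intCast_eq_zero_iff_even, hSym.apply i j]
    exact ⟨x i * (L i j * x j), by ring⟩
  · rintro ⟨i, j⟩ - h hij
    obtain rfl : j = i := congrArg Prod.fst hij
    apply h
    rw [ZMod.intCast_eq_zero_iff_even]
    exact ((hEven j).mul_right _).mul_left _

/-- Points of `x₀ + (ℤτ + ℤ)/b` close to `c`. -/
theorem exists_many_lattice_points {τ : ℂ} (hτ : 0 < τ.im) {b : ℕ} (hb : 0 < b) (x₀ c : ℂ)
    (n p : ℕ) : ∃ T : Finset ℂ, T.card = n * p ∧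
      (∀ z ∈ T, ∃ i j : ℤ, z = x₀ + (i * τ + j) / b) ∧
      ∀ z ∈ T, ‖z - c‖ ≤ (n * τ.im + p) / b := by
  classical
  have hb' : (0 : ℝ) < b := by exact_mod_cast hb
  have hbC : (b : ℂ) ≠ 0 := by exact_mod_cast hb.ne'
  let i₀ : ℤ := ⌊b * (c - x₀).im / τ.im⌋
  let j₀ : ℕ → ℤ := fun i => ⌊b * (c - x₀).re - (i₀ + i : ℤ) * τ.re⌋
  let P : ℕ × ℕ → ℂ := fun q => x₀ + (((i₀ + q.1 : ℤ) : ℂ) * τ + ((j₀ q.1 + q.2 : ℤ) : ℂ)) / b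
  have hinj : Function.Injective P := by
    rintro ⟨i, j⟩ ⟨i', j'⟩ h
    have h1 : ((i₀ + i : ℤ) : ℂ) * τ + ((j₀ i + j : ℤ) : ℂ) =
        ((i₀ + i' : ℤ) : ℂ) * τ + ((j₀ i' + j' : ℤ) : ℂ) := by
      have := add_left_cancel h
      field_simp at this
      linear_combination this
    have h2 := congrArg Complex.im h1
    simp at h2
    obtain rfl : i = i' := by
      rcases h2 with h2 | h2
      · exact h2
      · exact absurd h2 hτ.ne'
    have h3 := congrArg Complex.re h1
    simp at h3
    rw [h3]
  refine ⟨(Finset.range n ×ˢ Finset.range p).image P, ?_, ?_, ?_⟩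
  · rw [Finset.card_image_of_injective _ hinj]; simp
  · intro z hz
    obtain ⟨q, -, rfl⟩ := Finset.mem_image.1 hz
    exact ⟨_, _, rfl⟩
  · intro z hz
    obtain ⟨⟨i, j⟩, hq, rfl⟩ := Finset.mem_image.1 hz
    simp only [Finset.mem_product, Finset.mem_range] at hq
    obtain ⟨hi, hj⟩ := hq
    have hi' : (i : ℝ) + 1 ≤ n := by exact_mod_cast hi
    have hj' : (j : ℝ) + 1 ≤ p := by exact_mod_cast hj
    have key : ‖(P (i, j) - c) * b‖ ≤ n * τ.im + p := by
      have he : (P (i, j) - c) * b =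
          ((i₀ + i : ℤ) : ℂ) * τ + ((j₀ i + j : ℤ) : ℂ) - b * (c - x₀) := by
        simp only [P]; field_simp; ring
      rw [he]
      refine (Complex.norm_le_abs_re_add_abs_im _).trans ?_
      have a1 := Int.floor_le (b * (c - x₀).im / τ.im)
      have a2 := Int.lt_floor_add_one (b * (c - x₀).im / τ.im)
      rw [le_div_iff₀ hτ] at a1
      rw [div_lt_iff₀ hτ] at a2
      have b1 := Int.floor_le (b * (c - x₀).re - (i₀ + i : ℤ) * τ.re)
      have b2 := Int.lt_floor_add_one (b * (c - x₀).re - (i₀ + i : ℤ) * τ.re)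
      change (i₀ : ℝ) * _ ≤ _ at a1
      change _ < ((i₀ : ℝ) + 1) * _ at a2
      change (j₀ i : ℝ) ≤ _ at b1
      change _ < (j₀ i : ℝ) + 1 at b2
      rw [add_comm]
      have hiτ := mul_le_mul_of_nonneg_right hi' hτ.le
      have hi0 : 0 ≤ (i : ℝ) * τ.im := by positivity
      have hj0 : (0 : ℝ) ≤ j := by positivity
      push_cast at b1 b2
      simp at a1 a2 b1 b2
      apply add_le_add
      · simp
        rw [abs_le]
        constructor <;> linarith
      · simp
        rw [abs_le]
        constructor <;> linarith
    rw [norm_mul, Complex.norm_natCast] at key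
    rwa [le_div_iff₀ hb']

theorem norm_eC (w : ℂ) : ‖eC w‖ = Real.exp (-(2 * Real.pi * w.im)) := by
  rw [eC, Complex.norm_exp]
  congr 1
  simp

theorem eC_ne_zero (w : ℂ) : eC w ≠ 0 := Complex.exp_ne_zero _

theorem exists_norm_le_exp_sq {g : ℂ → ℂ} (hg : Continuous g) {τ c : ℂ} (hτ : 0 < τ.im) {m M : ℝ}
    (hM : 0 < M) (hm : m ≤ M)
    (hell : ∀ (i j : ℤ) (x : ℂ), g (x + i * τ + j) =
      eC (-(τ * (i ^ 2 * m) / 2) - i * (m * x + c)) * g x) :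
    ∃ K : ℝ, 0 ≤ K ∧ ∀ x, ‖g x‖ ≤ K * Real.exp (4 * Real.pi * M / τ.im * x.im ^ 2) := by
  have hcomp : IsCompact (Set.Icc (0 : ℝ) 1 ×ℂ Set.Icc (0 : ℝ) τ.im) :=
    isCompact_Icc.reProdIm isCompact_Icc
  obtain ⟨K, hK⟩ := hcomp.exists_bound_of_continuousOn hg.continuousOn
  have hπ := Real.pi_pos
  have hK0 : 0 ≤ K := (norm_nonneg _).trans (hK 0 (by simp [Complex.mem_reProdIm, hτ.le]))
  set B : ℝ := |m| * τ.im + |c.im| with hB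
  set y := τ.im with hy
  refine ⟨K * Real.exp (4 * Real.pi * M * y + Real.pi * B ^ 2 / (y * M)), by positivity,
    fun x => ?_⟩
  set i : ℤ := ⌊x.im / y⌋ with hi
  set j : ℤ := ⌊(x - i * τ).re⌋ with hj
  have a1 : (i : ℝ) ≤ x.im / y := Int.floor_le _
  have a2 : x.im / y < i + 1 := Int.lt_floor_add_one _
  have b1 : (j : ℝ) ≤ (x - i * τ).re := Int.floor_le _
  have b2 : (x - i * τ).re < j + 1 := Int.lt_floor_add_one _
  obtain ⟨u, hu⟩ : ∃ u : ℂ, u = x - i * τ - j := ⟨_, rfl⟩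
  have hx : x = u + i * τ + j := by rw [hu]; ring
  have hure : u.re = (x - i * τ).re - j := by rw [hu]; simp
  have huim : u.im = x.im - i * y := by rw [hu]; simp [hy]
  have a1' := (le_div_iff₀ hτ).1 a1
  have a2' := (div_lt_iff₀ hτ).1 a2
  have hu0 : 0 ≤ u.im := by rw [huim]; linarith
  have hu1 : u.im ≤ y := by rw [huim]; linarith
  have hgu : ‖g u‖ ≤ K := by
    refine hK u ?_
    rw [Complex.mem_reProdIm]
    refine ⟨⟨?_, ?_⟩, hu0, hu1⟩ <;> rw [hure] <;> linarith
  have him : (-(τ * ((i : ℂ) ^ 2 * m) / 2) - i * (m * u + c)).im =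
      -(y * i ^ 2 * m / 2) - i * (m * u.im + c.im) := by
    have : (-(τ * ((i : ℂ) ^ 2 * m) / 2) - i * (m * u + c)) =
      -(((i ^ 2 * m / 2 : ℝ) : ℂ) * τ) - ((i : ℝ) : ℂ) * ((m : ℂ) * u + c) := by
      push_cast; ring
    rw [this, Complex.sub_im, Complex.neg_im, Complex.im_ofReal_mul, Complex.im_ofReal_mul,
      Complex.add_im, Complex.im_ofReal_mul]
    ring
  have hexp : -(2 * Real.pi * (-(y * i ^ 2 * m / 2) - i * (m * u.im + c.im))) ≤
      4 * Real.pi * M / y * x.im ^ 2 + (4 * Real.pi * M * y + Real.pi * B ^ 2 / (y * M)) := by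
    have h1 : y * (i : ℝ) ^ 2 * m ≤ y * i ^ 2 * M := by gcongr
    have h2 : (i : ℝ) * (m * u.im + c.im) ≤ |(i : ℝ)| * B := by
      refine (le_abs_self _).trans ?_
      rw [abs_mul]
      refine mul_le_mul_of_nonneg_left ((abs_add_le _ _).trans ?_) (abs_nonneg _)
      rw [hB, abs_mul, abs_of_nonneg hu0]
      gcongr
    have h3 : 2 * (|(i : ℝ)| * B) ≤ y * M * i ^ 2 + B ^ 2 / (y * M) := by
      have hyM : 0 < y * M := by positivity
      have : y * M * i ^ 2 + B ^ 2 / (y * M) - 2 * (|(i : ℝ)| * B) =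
          (y * M * |(i : ℝ)| - B) ^ 2 / (y * M) := by
        rw [← sq_abs (i : ℝ)]; field_simp; ring
      have h4 : 0 ≤ (y * M * |(i : ℝ)| - B) ^ 2 / (y * M) := by positivity
      linarith
    have h4 : (i : ℝ) ^ 2 ≤ 2 * (x.im / y) ^ 2 + 2 := by
      nlinarith [sq_nonneg ((i : ℝ) - 2 * (x.im / y)), sq_nonneg ((i : ℝ) - (x.im / y)),
        sq_nonneg ((i : ℝ) + 2 - (x.im / y)), sq_nonneg (2 * (x.im / y) - i)]
    have h5 : y * M * i ^ 2 ≤ 2 * (M / y * x.im ^ 2) + 2 * M * y := by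
      calc y * M * i ^ 2 ≤ y * M * (2 * (x.im / y) ^ 2 + 2) := by gcongr
        _ = _ := by field_simp
    calc -(2 * Real.pi * (-(y * i ^ 2 * m / 2) - i * (m * u.im + c.im)))
        = Real.pi * (y * i ^ 2 * m + 2 * (i * (m * u.im + c.im))) := by ring
      _ ≤ Real.pi * (4 * (M / y * x.im ^ 2) + 4 * M * y + B ^ 2 / (y * M)) := by
          refine mul_le_mul_of_nonneg_left ?_ hπ.le
          linarith
      _ = _ := by ring
  calc ‖g x‖ = ‖eC (-(τ * ((i : ℂ) ^ 2 * m) / 2) - i * (m * u + c))‖ * ‖g u‖ := by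
        rw [hx, hell, norm_mul]
    _ ≤ Real.exp (4 * Real.pi * M / y * x.im ^ 2 +
          (4 * Real.pi * M * y + Real.pi * B ^ 2 / (y * M))) * K := by
        rw [norm_eC, him]
        gcongr
    _ = _ := by rw [Real.exp_add]; ring

theorem eq_zero_of_vanishing_on_division_points {g : ℂ → ℂ} (hg : Differentiable ℂ g) {τ c : ℂ}
    (hτ : 0 < τ.im) {m M : ℝ} (hM : 1 ≤ M) (hm : m ≤ M)
    (hell : ∀ (i j : ℤ) (x : ℂ), g (x + i * τ + j) =
      eC (-(τ * (i ^ 2 * m) / 2) - i * (m * x + c)) * g x)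
    {b : ℕ} (hb : 100 * M ≤ b) (x₀ : ℂ) (hzero : ∀ i j : ℤ, g (x₀ + (i * τ + j) / b) = 0)
    (a : ℂ) : g a = 0 := by
  have hM0 : 0 < M := by linarith
  obtain ⟨K, hK0, hK⟩ := exists_norm_le_exp_sq hg.continuous hτ hM0 hm hell
  have hb0 : (0 : ℝ) < b := by linarith
  set y := τ.im with hy
  set C : ℝ := 4 * Real.pi * M / y with hC
  have hπ := Real.pi_pos
  have hC0 : 0 < C := by positivity
  have main : ∀ n : ℕ, ‖g a‖ ≤ K * Real.exp (C * (2 * a.im ^ 2 + 64)) *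
      Real.exp (-(y / 2 * (n : ℝ) ^ 2)) := by
    intro n
    set p : ℕ := ⌈n * y⌉₊ with hp
    have hp1 : n * y ≤ p := Nat.le_ceil _
    have hp2 : (p : ℝ) < n * y + 1 := Nat.ceil_lt_add_one (by positivity)
    obtain ⟨T, hcard, hT, hTr⟩ :=
      exists_many_lattice_points hτ (by exact_mod_cast hb0) x₀ a n p
    set r : ℝ := (2 * n * y + 1) / b with hr
    have hr0 : 0 < r := by positivity
    set D : ℝ := K * Real.exp (C * (2 * a.im ^ 2 + 32 * r ^ 2)) with hD
    have hbound : ∀ x, ‖x - a‖ = 4 * r → ‖g x‖ ≤ D := by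
      intro x hx
      refine (hK x).trans ?_
      rw [hD]
      gcongr
      have h1 : (x - a).im ^ 2 ≤ (4 * r) ^ 2 := by
        rw [← sq_abs, ← hx]
        gcongr
        exact Complex.abs_im_le_norm _
      rw [Complex.sub_im] at h1
      nlinarith [sq_nonneg (x.im - 2 * a.im)]
    have h := norm_le_of_zeros T a hr0 (fun z hz => (hTr z hz).trans ?_) g D hg ?_ hbound
    · refine h.trans ?_
      have h3 : ((1 : ℝ) / 3) ^ T.card ≤ Real.exp (-(y * (n : ℝ) ^ 2)) := by
        have h4 : (1 : ℝ) / 3 ≤ Real.exp (-1) := by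
          rw [Real.exp_neg, one_div]
          apply inv_anti₀ (Real.exp_pos _)
          linarith [Real.exp_one_lt_d9]
        calc ((1 : ℝ) / 3) ^ T.card ≤ Real.exp (-1) ^ T.card := by gcongr
          _ = Real.exp (-((n : ℝ) * p)) := by rw [← Real.exp_nat_mul, hcard]; push_cast; ring_nf
          _ ≤ _ := by
            apply Real.exp_le_exp.2
            have : (n : ℝ) * (n * y) ≤ n * p := by gcongr
            linarith
      calc D * (1 / 3) ^ T.card ≤ D * Real.exp (-(y * (n : ℝ) ^ 2)) := by
            gcongr
        _ = K * Real.exp (C * (2 * a.im ^ 2 + 32 * r ^ 2) + -(y * (n : ℝ) ^ 2)) := by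
            rw [hD, Real.exp_add]; ring
        _ ≤ K * Real.exp (C * (2 * a.im ^ 2 + 64) + -(y / 2 * (n : ℝ) ^ 2)) := by
            gcongr ?_ * Real.exp ?_
            have hr2 : r ^ 2 ≤ (8 * n ^ 2 * y ^ 2 + 2) / b ^ 2 := by
              rw [hr, div_pow]
              gcongr
              nlinarith [sq_nonneg (2 * n * y - 1)]
            have hb2 : 10000 * M ≤ (b : ℝ) ^ 2 := by nlinarith
            have hr3 : r ^ 2 ≤ (8 * n ^ 2 * y ^ 2 + 2) / (10000 * M) :=
              hr2.trans (by gcongr)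
            have h5 : C * (32 * r ^ 2) ≤ C * 64 + y / 2 * (n : ℝ) ^ 2 := by
              calc C * (32 * r ^ 2) ≤ C * (32 * ((8 * n ^ 2 * y ^ 2 + 2) / (10000 * M))) := by
                    gcongr
                _ = Real.pi * (1024 / 10000) * (y * n ^ 2) + C * (64 / (10000 * M)) := by
                    rw [hC]; field_simp; ring
                _ ≤ 4 * (1024 / 10000) * (y * n ^ 2) + C * 64 := by
                    gcongr
                    · exact Real.pi_le_four
                    · exact div_le_self (by norm_num) (by linarith)
                _ ≤ _ := by
                    have : 0 ≤ y * (n : ℝ) ^ 2 := by positivity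
                    linarith
            linarith
        _ = _ := by rw [Real.exp_add]; ring
    · refine div_le_div_of_nonneg_right ?_ hb0.le
      rw [← hy]
      linarith
    · intro z hz
      obtain ⟨i, j, rfl⟩ := hT z hz
      exact hzero i j
  have hlim : Filter.Tendsto (fun n : ℕ => K * Real.exp (C * (2 * a.im ^ 2 + 64)) *
      Real.exp (-(y / 2 * (n : ℝ) ^ 2))) Filter.atTop (nhds 0) := by
    rw [← mul_zero (K * Real.exp (C * (2 * a.im ^ 2 + 64)))]
    refine Filter.Tendsto.const_mul _ (Real.tendsto_exp_neg_atTop_nhds_zero.comp ?_)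
    exact ((Filter.tendsto_pow_atTop two_ne_zero).comp
      tendsto_natCast_atTop_atTop).const_mul_atTop (by positivity)
  exact norm_le_zero_iff.1 (ge_of_tendsto' hlim main)

theorem eC_add (x y : ℂ) : eC (x + y) = eC x * eC y := by
  rw [eC, eC, eC, ← Complex.exp_add, mul_add]

theorem eC_intCast (n : ℤ) : eC n = 1 := by
  rw [eC, mul_comm]
  exact Complex.exp_int_mul_two_pi_mul_I n

theorem zc_dotProduct_mulVec_zc {N : ℕ} (L : Matrix (Fin N) (Fin N) ℤ) (lam mu : Fin N → ℤ) :
    zc lam ⬝ᵥ (L.map (Int.cast : ℤ → ℂ)).mulVec (zc mu) = ((lam ⬝ᵥ L.mulVec mu : ℤ) : ℂ) := by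
  simp [dotProduct, Matrix.mulVec, zc]

theorem isElliptic_slash {N : ℕ} {L : Matrix (Fin N) (Fin N) ℤ} (hSym : L.IsSymm)
    (hEven : ∀ i, Even (L i i)) {a b c d : ℤ} (hdet : a * d - b * c = 1) {τ τ' : ℂ}
    (hJ : c * τ + d ≠ 0) (hτ' : τ' = (a * τ + b) / (c * τ + d)) {f : (Fin N → ℂ) → ℂ}
    (hf : IsElliptic L τ' f) :
    IsElliptic L τ (fun z => eC (-(c * (z ⬝ᵥ (L.map (Int.cast : ℤ → ℂ)).mulVec z) /
      (2 * (c * τ + d)))) * f (fun i => z i / (c * τ + d))) := by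
  intro lam mu z
  have hdetC : (a : ℂ) * d - b * c = 1 := by exact_mod_cast hdet
  set J : ℂ := c * τ + d with hJdef
  set A := L.map (Int.cast : ℤ → ℂ) with hA
  have hAsymm : A.IsSymm := hSym.map _
  let B := Matrix.toBilin' A
  have hB : ∀ x y, x ⬝ᵥ A.mulVec y = B x y := fun x y => (Matrix.toBilin'_apply' A x y).symm
  have hcomm : ∀ x y, B x y = B y x := by
    intro x y
    rw [← hB, ← hB, Matrix.dotProduct_mulVec, ← Matrix.mulVec_transpose, hAsymm.eq,
      dotProduct_comm]
  obtain ⟨p, hp⟩ := even_dotProduct_mulVec_self hSym hEven lam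
  obtain ⟨q, hq⟩ := even_dotProduct_mulVec_self hSym hEven mu
  have hp' : B (zc lam) (zc lam) = 2 * p := by
    rw [← hB, hA, zc_dotProduct_mulVec_zc, hp]; push_cast; ring
  have hq' : B (zc mu) (zc mu) = 2 * q := by
    rw [← hB, hA, zc_dotProduct_mulVec_zc, hq]; push_cast; ring
  obtain ⟨r, hr⟩ : ∃ r : ℤ, B (zc lam) (zc mu) = r := by
    exact ⟨_, by rw [← hB, hA, zc_dotProduct_mulVec_zc]⟩
  have harg : (fun i => (z i + lam i * τ + mu i) / J) =
      fun i => z i / J + ((fun i => d * lam i - c * mu i : Fin N → ℤ) i : ℂ) * τ' +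
        ((fun i => a * mu i - b * lam i : Fin N → ℤ) i : ℂ) := by
    funext i
    rw [hτ']
    push_cast
    field_simp
    rw [hJdef]
    linear_combination (-(lam i : ℂ) * τ - mu i) * hdetC
  have hv : (fun i => z i + (lam i : ℂ) * τ + mu i) = z + τ • zc lam + zc mu := by
    funext i; simp [zc]; ring
  have hlam : zc (fun i => d * lam i - c * mu i) = (d : ℂ) • zc lam - (c : ℂ) • zc mu := by
    funext i; simp [zc]
  have hz : (fun i => z i / J) = J⁻¹ • z := by
    funext i; simp; ring
  have hkey := hf (fun i => d * lam i - c * mu i) (fun i => a * mu i - b * lam i)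
    (fun i => z i / J)
  rw [← harg, hlam] at hkey
  simp only
  rw [hkey, ← mul_assoc, ← mul_assoc, ← eC_add, ← eC_add]
  congr 1
  rw [hv, hz]
  simp only [← hA, hB]
  simp only [map_add, map_sub, map_smul, LinearMap.add_apply, LinearMap.sub_apply,
    LinearMap.smul_apply, smul_eq_mul, hcomm _ z, hcomm (zc mu) (zc lam), hp', hq', hr]
  rw [← mul_one (eC (_ + -(_ / _))), ← eC_intCast (-(b * d * p + a * c * q - b * c * r)), ← eC_add]
  congr 1
  have h0 : (c * τ + d) * J⁻¹ = 1 := mul_inv_cancel₀ hJ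
  have h1 : J⁻¹ = a - c * τ' := by
    rw [hτ']
    field_simp
    rw [hJdef]
    linear_combination -hdetC
  have h2 : τ * J⁻¹ = d * τ' - b := by
    rw [hτ']
    field_simp
    rw [hJdef]
    linear_combination -τ * hdetC
  rw [mul_comm 2 J]
  simp only [div_eq_mul_inv, mul_inv]
  generalize J⁻¹ = u at h0 h1 h2 ⊢
  push_cast
  linear_combination (-(B z (zc lam)) - τ * p) * h0 + (p * d - r * c) * h2 - c * q * h1

theorem eq_zero_of_vanishing_on_line {N : ℕ} {L : Matrix (Fin N) (Fin N) ℤ} {τ : ℂ}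
    (hτ : 0 < τ.im) {F : (Fin N → ℂ) → ℂ} (hF : Differentiable ℂ F) (hell : IsElliptic L τ F)
    {M : ℝ} (hM : 1 ≤ M) (hLM : ∀ i, (L i i : ℝ) ≤ M) {b : ℕ} (hb : 100 * M ≤ b)
    (hline : ∀ w : ℂ, F (fun i => w * (b : ℂ) ^ (i : ℕ)) = 0) (v : Fin N → ℂ) : F v = 0 := by
  have hbC : (b : ℂ) ≠ 0 := by
    have : (b : ℝ) ≠ 0 := by linarith
    exact_mod_cast this
  suffices h : ∀ p ≤ N, ∀ (z : Fin N → ℂ) (w : ℂ),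
      F (fun i => if (i : ℕ) < p then z i else w * (b : ℂ) ^ ((i : ℕ) - p)) = 0 by
    simpa using h N le_rfl v 0
  intro p
  induction p with
  | zero => simpa using hline
  | succ p ih =>
    intro hpN z w
    let e : Fin N := ⟨p, hpN⟩
    let A := L.map (Int.cast : ℤ → ℂ)
    let v₀ : Fin N → ℂ := fun i => if (i : ℕ) < p + 1 then z i else w * (b : ℂ) ^ ((i : ℕ) - (p + 1))
    have hupd : ∀ x : ℂ, Function.update v₀ e x = Function.update v₀ e 0 + Pi.single e x := by
      intro x
      funext i
      by_cases hi : i = e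
      · subst hi; simp
      · simp [hi]
    have hdiff : Differentiable ℂ (fun x : ℂ => F (Function.update v₀ e x)) :=
      hF.comp fun x => (hasFDerivAt_update v₀ x).differentiableAt
    have hzero := eq_zero_of_vanishing_on_division_points (g := fun x => F (Function.update v₀ e x))
      hdiff hτ hM (hLM e) (c := A.mulVec (Function.update v₀ e 0) e) ?_ hb (w / b) ?_ (z e)
    · have : Function.update v₀ e (z e) = v₀ := by
        rw [Function.update_eq_self_iff]
        simp [v₀, e]
      simpa only [this] using hzero
    · intro i j x
      have h := hell (Pi.single e i) (Pi.single e j) (Function.update v₀ e x)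
      have hz : ∀ n : ℤ, zc (Pi.single e n : Fin N → ℤ) = Pi.single e (n : ℂ) := by
        intro n
        funext l
        by_cases hl : l = e
        · subst hl; simp [zc]
        · simp [zc, hl]
      have harg : (fun l => Function.update v₀ e x l + ((Pi.single e i : Fin N → ℤ) l : ℂ) * τ +
          ((Pi.single e j : Fin N → ℤ) l : ℂ)) = Function.update v₀ e (x + i * τ + j) := by
        funext l
        by_cases hl : l = e
        · subst hl; simp
        · simp [hl]
      rw [harg, hz, single_dotProduct, single_dotProduct, hupd x, Matrix.mulVec_add,
        ← hupd x] at h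
      refine h.trans ?_
      congr 2
      rw [Pi.add_apply, Matrix.mulVec_single]
      simp [A]
      ring
    · intro i j
      have h := ih (by omega) z ((w + (i * τ + j)) / b)
      let lam : ℤ → Fin N → ℤ := fun n l =>
        if (l : ℕ) < p + 1 then 0 else n * (b : ℤ) ^ ((l : ℕ) - (p + 1))
      have h' := hell (lam i) (lam j) (Function.update v₀ e (w / b + (i * τ + j) / b))
      have harg : (fun l => Function.update v₀ e (w / b + (i * τ + j) / b) l +
          (lam i l : ℂ) * τ + (lam j l : ℂ)) =
          fun l : Fin N => if (l : ℕ) < p then z l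
            else (w + (i * τ + j)) / b * (b : ℂ) ^ ((l : ℕ) - p) := by
        funext l
        rcases lt_trichotomy (l : ℕ) p with hl | hl | hl
        · have hne : l ≠ e := by rintro rfl; simp [e] at hl
          simp [lam, v₀, hne, hl, hl.le]
        · obtain rfl : l = e := Fin.ext hl
          simp [lam, e, add_div]
        · have hne : l ≠ e := by rintro rfl; simp [e] at hl
          have h1 : (l : ℕ) - p = (l - (p + 1)) + 1 := by omega
          simp only [lam, v₀, Function.update_of_ne hne, if_neg (show ¬ (l : ℕ) < p + 1 by omega),
            if_neg (show ¬ (l : ℕ) < p by omega), h1, pow_succ]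
          push_cast
          field_simp
          ring
      rw [harg, h] at h'
      exact (mul_eq_zero.1 h'.symm).resolve_left (eC_ne_zero _)

/-- For a positive definite Jacobi index `L` of rank `N ≥ 2` there is a
finite set `S` of nonzero vectors in `ℤ^N`, depending only on `L`, such that: if
`φ : ℍ × ℂ^N → ℂ` is holomorphic in `z`, `1`-periodic in `τ`, elliptic with respect to
`L` and `τ` for every `τ`, and all the scalar restrictions `φ_s(τ, w) = φ(τ, w·s)`,
`s ∈ S`, satisfy the weight-`k` index-`sᵀLs` Jacobi transformation laws, then `φ`
satisfies the weight-`k` index-`L` Jacobi transformation laws. -/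
theorem jacobi_laws_by_scalar_restrictions
    (N : ℕ) (hN : 2 ≤ N) (L : Matrix (Fin N) (Fin N) ℤ)
    (hSym : L.IsSymm) (hEven : ∀ i, Even (L i i))
    (hPos : (L.map (Int.cast : ℤ → ℝ)).PosDef) :
    ∃ S : Finset (Fin N → ℤ), (∀ s ∈ S, s ≠ 0) ∧
      ∀ (k : ℤ) (φ : UpperHalfPlane → (Fin N → ℂ) → ℂ),
        (∀ τ : UpperHalfPlane, Differentiable ℂ (φ τ)) →
        (∀ (τ : UpperHalfPlane) (z : Fin N → ℂ), φ ((1 : ℝ) +ᵥ τ) z = φ τ z) →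
        (∀ τ : UpperHalfPlane, IsElliptic L (τ : ℂ) (φ τ)) →
        (∀ s ∈ S, SatisfiesJacobiLaws k (!![s ⬝ᵥ L.mulVec s])
          (fun τ (w : Fin 1 → ℂ) => φ τ (fun i => w 0 * (s i : ℂ)))) →
        SatisfiesJacobiLaws k L φ := by
  classical
  let M : ℕ := 1 + ∑ i, (L i i).natAbs
  have hLM : ∀ i, (L i i : ℝ) ≤ (M : ℝ) := by
    intro i
    have h1 : (L i i).natAbs ≤ ∑ i, (L i i).natAbs :=
      Finset.single_le_sum (f := fun i => (L i i).natAbs) (fun _ _ => Nat.zero_le _)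
        (Finset.mem_univ i)
    have h2 : L i i ≤ (M : ℤ) := by simp only [M]; omega
    exact_mod_cast h2
  have hM : (1 : ℝ) ≤ (M : ℝ) := by exact_mod_cast Nat.le_add_right 1 _
  let b : ℕ := 100 * M
  have hb : 100 * (M : ℝ) ≤ (b : ℝ) := by simp [b]
  let s : Fin N → ℤ := fun i => (b : ℤ) ^ (i : ℕ)
  refine ⟨{s}, ?_, ?_⟩
  · intro t ht h0
    rw [Finset.mem_singleton] at ht
    have := congrFun (ht.symm.trans h0) ⟨0, by omega⟩
    simp [s] at this
  · intro k φ hφ _ hell hres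
    refine ⟨fun γ τ z => ?_, hell⟩
    have hs := (hres s (Finset.mem_singleton_self s)).1 γ τ
    have hJ : (γ 1 0 : ℂ) * (τ : ℂ) + (γ 1 1 : ℂ) ≠ 0 := by
      rw [← ModularGroup.denom_apply]
      exact UpperHalfPlane.denom_ne_zero _ _
    have hdet : γ 0 0 * γ 1 1 - γ 0 1 * γ 1 0 = 1 := by
      rw [← Matrix.det_fin_two, γ.det_coe]
    have hτ' : ((γ • τ : UpperHalfPlane) : ℂ) =
        ((γ 0 0 : ℂ) * τ + (γ 0 1 : ℂ)) / ((γ 1 0 : ℂ) * τ + (γ 1 1 : ℂ)) := by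
      rw [UpperHalfPlane.coe_specialLinearGroup_apply]
      simp
    have hslash := isElliptic_slash hSym hEven hdet hJ hτ' (hell (γ • τ))
    set J : ℂ := (γ 1 0 : ℂ) * (τ : ℂ) + (γ 1 1 : ℂ) with hJdef
    set A := L.map (Int.cast : ℤ → ℂ) with hA
    let F : (Fin N → ℂ) → ℂ := fun z =>
      eC (-((γ 1 0 : ℂ) * (z ⬝ᵥ A.mulVec z) / (2 * J))) * φ (γ • τ) (fun i => z i / J) -
        J ^ k * φ τ z
    have hFell : IsElliptic L τ F := by
      intro lam mu z
      have h1 := hslash lam mu z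
      have h2 := hell τ lam mu z
      simp only at h1
      simp only [F]
      rw [h1, h2]
      ring
    have hFdiff : Differentiable ℂ F := by
      have h1 : Differentiable ℂ fun z : Fin N → ℂ => z ⬝ᵥ A.mulVec z := by
        simp only [dotProduct, Matrix.mulVec]
        fun_prop
      have h2 : Differentiable ℂ fun z : Fin N → ℂ => φ (γ • τ) (fun i => z i / J) :=
        (hφ (γ • τ)).comp (by fun_prop)
      have h3 := hφ τ
      simp only [F, eC]
      fun_prop
    have hinv : ∀ x : ℂ, eC x * eC (-x) = 1 := by
      intro x
      rw [← eC_add, add_neg_cancel]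
      exact_mod_cast eC_intCast 0
    have hline : ∀ w : ℂ, F (fun i => w * (b : ℂ) ^ (i : ℕ)) = 0 := by
      intro w
      have h := hs (fun _ => w)
      simp only at h
      have hQ : (fun i : Fin N => w * (b : ℂ) ^ (i : ℕ)) ⬝ᵥ
          A.mulVec (fun i : Fin N => w * (b : ℂ) ^ (i : ℕ)) =
          (fun _ : Fin 1 => w) ⬝ᵥ ((!![s ⬝ᵥ L.mulVec s]).map (Int.cast : ℤ → ℂ)).mulVec
            (fun _ : Fin 1 => w) := by
        have : (fun i : Fin N => w * (b : ℂ) ^ (i : ℕ)) = w • zc s := by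
          funext i; simp [zc, s]
        rw [this, Matrix.mulVec_smul, dotProduct_smul, smul_dotProduct, zc_dotProduct_mulVec_zc]
        simp only [dotProduct, Matrix.mulVec, Finset.univ_unique, Finset.sum_singleton,
          Matrix.map_apply, smul_eq_mul]
        simp
        left
        ring
      have harg : (fun i : Fin N => w * (b : ℂ) ^ (i : ℕ) / J) =
          fun i => w / J * (s i : ℂ) := by
        funext i; simp [s]; ring
      have harg' : (fun i : Fin N => w * (b : ℂ) ^ (i : ℕ)) = fun i => w * (s i : ℂ) := by
        funext i; simp [s]
      simp only [F]
      have hw := hinv ((γ 1 0 : ℂ) * ((fun i : Fin N => w * (b : ℂ) ^ (i : ℕ)) ⬝ᵥ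
        A.mulVec (fun i : Fin N => w * (b : ℂ) ^ (i : ℕ))) / (2 * J))
      rw [hQ] at hw
      rw [hQ, harg, harg', h]
      linear_combination (J ^ k * φ τ fun i => w * (s i : ℂ)) * hw
    have h := eq_zero_of_vanishing_on_line τ.im_pos hFdiff hFell hM hLM hb hline z
    simp only [F, sub_eq_zero] at h
    rw [mul_right_comm, ← h]
    linear_combination (-φ (γ • τ) fun i => z i / J) *
      hinv ((γ 1 0 : ℂ) * (z ⬝ᵥ A.mulVec z) / (2 * J))
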